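/- arXiv:hep-th/0006106 — 5 statements merged into one kernel-verified Lean document; each statement's English description precedes it below -/
import Mathlib

section
/- (The geometrical lemma.) Let n ≥ 2 and let X = (x₁, …, xₙ) ∈ (ℝ⁴)ⁿ. For each subset I with ∅ ⊊ I ⊊ {1, …, n}, let C_I := {X ∈ (ℝ⁴)ⁿ : x_i ≳ x_{i'} for every i ∈ I and every i' ∉ I}. Then the union of the sets C_I over all subsets I with ∅ ⊊ I ⊊ {1, …, n} equals (ℝ⁴)ⁿ \ Dₙ, where Dₙ := {X ∈ (ℝ⁴)ⁿ : x₁ = x₂ = ⋯ = xₙ} is the complete diagonal. Equivalently: for every such I there exist i ∈ I and i' ∉ I with x_i ≤ x_{i'} if and only if x₁ = ⋯ = xₙ. -/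
open scoped RealInnerProductSpace

/-- A point of Minkowski space `M₄`: time component in `ℝ`, spatial part in `ℝ³`. -/
abbrev Mink : Type := ℝ × EuclideanSpace ℝ (Fin 3)

/-- The Minkowski square `ξ² = (ξ⁰)² − ‖ξ⃗‖²` (signature `(+,−,−,−)`). -/
noncomputable def minkSq (ξ : Mink) : ℝ := ξ.1 ^ 2 - ‖ξ.2‖ ^ 2

/-- Membership in the closed past light cone `V̄⁻`. -/
def inPastCone (ξ : Mink) : Prop := ξ.1 ≤ 0 ∧ 0 ≤ minkSq ξ

/-- The causal order: `x ≤ y` iff `x − y ∈ V̄⁻`. -/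
def causalLE (x y : Mink) : Prop := inPastCone (x - y)

/-- `x ≳ y` iff `x − y ∉ V̄⁻`. -/
def notPast (x y : Mink) : Prop := ¬ inPastCone (x - y)

/-- `x ∼ y` iff `x ≳ y` and `y ≳ x`. -/
def spacelikeSep (x y : Mink) : Prop := notPast x y ∧ notPast y x

/-- If `x ≤ y` and the time component of `y` does not exceed that of `x`, then `x = y`. -/
theorem causalLE.eq_of_fst_le {x y : Mink} (h : causalLE x y) (ht : y.1 ≤ x.1) : x = y := by
  obtain ⟨h₁, h₂⟩ := h
  simp only [minkSq, Prod.fst_sub, Prod.snd_sub] at h₁ h₂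
  have h₀ : x.1 - y.1 = 0 := by linarith
  have hs : ‖x.2 - y.2‖ = 0 := by
    rw [h₀] at h₂
    exact pow_eq_zero_iff two_ne_zero |>.1 (le_antisymm (by linarith) (sq_nonneg _))
  exact Prod.ext (sub_eq_zero.1 h₀) (sub_eq_zero.1 (norm_eq_zero.1 hs))

/-- The causal order is reflexive. -/
theorem causalLE_refl (x : Mink) : causalLE x x := by
  simp [causalLE, inPastCone, minkSq]

/-- Every nontrivial index set contains some `i` with `X i ≤ X i'` for some `i'` outside it
iff all the points of the family coincide. -/
theorem forall_exists_causalLE_iff {ι : Type*} [Fintype ι] (X : ι → Mink) :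
    (∀ I : Finset ι, I.Nonempty → I ≠ Finset.univ →
        ∃ i ∈ I, ∃ i' ∉ I, causalLE (X i) (X i')) ↔
      ∀ i j : ι, X i = X j := by
  classical
  constructor
  · intro h a b
    have : Nonempty ι := ⟨a⟩
    obtain ⟨m, hm⟩ := Finite.exists_max fun i => (X i).1
    by_cases hI : Finset.univ.filter (fun i => X i = X m) = Finset.univ
    · simp only [Finset.filter_eq_self, Finset.mem_univ, true_implies] at hI
      rw [hI a, hI b]
    · obtain ⟨i, hi, i', hi', hle⟩ := h _ ⟨m, by simp⟩ hI
      simp only [Finset.mem_filter, Finset.mem_univ, true_and] at hi hi'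
      rw [hi] at hle
      exact absurd (hle.eq_of_fst_le (hm i')).symm hi'
  · rintro h I ⟨i, hi⟩ hI
    obtain ⟨i', hi'⟩ : ∃ i', i' ∉ I := by simpa [Finset.eq_univ_iff_forall] using hI
    exact ⟨i, hi, i', hi', h i i' ▸ causalLE_refl _⟩

/-- the geometrical lemma: the union of the cones
`C_I = {X : x_i ≳ x_{i'} for all i ∈ I, i' ∉ I}` over all nontrivial subsets `I` of the
index set equals the complement of the complete diagonal `Dₙ`; equivalently, for every
such `I` there are `i ∈ I`, `i' ∉ I` with `x_i ≤ x_{i'}` iff all the points coincide. -/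
theorem geometrical_lemma (n : ℕ) (hn : 2 ≤ n) :
    ((⋃ I ∈ {I : Finset (Fin n) | I.Nonempty ∧ I ≠ Finset.univ},
        {X : Fin n → Mink | ∀ i ∈ I, ∀ i' ∉ I, notPast (X i) (X i')})
      = {X : Fin n → Mink | ∀ i j : Fin n, X i = X j}ᶜ) ∧
    (∀ X : Fin n → Mink,
      (∀ I : Finset (Fin n), I.Nonempty → I ≠ Finset.univ →
          ∃ i ∈ I, ∃ i' ∉ I, causalLE (X i) (X i')) ↔
        ∀ i j : Fin n, X i = X j) := by
  refine ⟨?_, fun X => forall_exists_causalLE_iff X⟩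
  ext X
  simp only [Set.mem_compl_iff, Set.mem_ofPred_eq, ← forall_exists_causalLE_iff X, Set.mem_iUnion]
  push Not
  simp only [notPast, causalLE, exists_prop, and_assoc]
end

section
/- The Epstein–Glaser subtraction operator W maps test functions into the space 𝒟_ω of functions flat to order ω at the origin: for every smooth φ : ℝ^d → ℝ and every multi-index a with |a| ≤ ω, the iterated partial derivative ∂_a(Wφ) vanishes at 0, i.e. ∂_a(Wφ)(0) = 0. -/
open Finset

/-- The partial derivative `∂ᵢ` of a function on `ℝ^d`. -/
noncomputable def pderivFun {d : ℕ} (i : Fin d) (f : (Fin d → ℝ) → ℝ) : (Fin d → ℝ) → ℝ :=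
  fun x => fderiv ℝ f x (Pi.single i 1)

/-- The iterated partial derivative `∂_a` associated to a multi-index `a : Fin d → ℕ`. -/
noncomputable def mderiv {d : ℕ} (a : Fin d → ℕ) (f : (Fin d → ℝ) → ℝ) : (Fin d → ℝ) → ℝ :=
  (List.finRange d).foldr (fun i g => (pderivFun i)^[a i] g) f

/-- The Epstein–Glaser subtraction operator `W = W_{ω,w}`:
`(Wφ)(x) = φ(x) − w(x) Σ_{|a| ≤ ω} (x^a / a!) ∂_aφ(0)`. -/
noncomputable def EGsub (d ω : ℕ) (w φ : (Fin d → ℝ) → ℝ) : (Fin d → ℝ) → ℝ :=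
  fun x => φ x - w x *
    ∑ a ∈ Finset.univ.filter (fun a : Fin d → Fin (ω + 1) => (∑ i, ((a i : ℕ))) ≤ ω),
      ((∏ i, x i ^ (a i : ℕ)) / ((∏ i, Nat.factorial (a i : ℕ) : ℕ) : ℝ)) *
        mderiv (fun i => (a i : ℕ)) φ 0

/-- `w` is an admissible auxiliary function of order `ω`: it is smooth, `w(0) = 1`, and
`∂_a w(0) = 0` for all multi-indices `a` with `1 ≤ |a| ≤ ω`. -/
def IsAdmissible (d ω : ℕ) (w : (Fin d → ℝ) → ℝ) : Prop :=
  ContDiff ℝ (⊤ : ℕ∞) w ∧ w 0 = 1 ∧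
    ∀ a : Fin d → ℕ, 1 ≤ ∑ i, a i → (∑ i, a i) ≤ ω → mderiv a w 0 = 0

section FoldrDerivatives

variable {d : ℕ}

theorem foldr_iterate_induction {ι : Type*} {R : (ι → (Fin d → ℝ) → ℝ) → Prop}
    (h : ∀ i f, R f → R fun j => pderivFun i (f j)) (a : Fin d → ℕ) (l : List (Fin d))
    {f : ι → (Fin d → ℝ) → ℝ} (hf : R f) :
    R fun j => l.foldr (fun i g => (pderivFun i)^[a i] g) (f j) := by
  have iter : ∀ i k (f : ι → (Fin d → ℝ) → ℝ), R f → R fun j => (pderivFun i)^[k] (f j) := by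
    intro i k
    induction k with
    | zero => exact fun f hf => hf
    | succ k ih => exact fun f hf => ih _ (h i f hf)
  induction l with
  | nil => exact hf
  | cons i l ih => exact iter i (a i) _ ih

theorem contDiff_pderivFun {f : (Fin d → ℝ) → ℝ} (hf : ContDiff ℝ (⊤ : ℕ∞) f) (i : Fin d) :
    ContDiff ℝ (⊤ : ℕ∞) (pderivFun i f) :=
  (hf.fderiv_right (m := (⊤ : ℕ∞)) (by simp)).clm_apply contDiff_const

theorem contDiff_foldr {f : (Fin d → ℝ) → ℝ} (hf : ContDiff ℝ (⊤ : ℕ∞) f) (a : Fin d → ℕ)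
    (l : List (Fin d)) :
    ContDiff ℝ (⊤ : ℕ∞) (l.foldr (fun i g => (pderivFun i)^[a i] g) f) :=
  foldr_iterate_induction (ι := Unit) (R := fun f => ContDiff ℝ (⊤ : ℕ∞) (f ()))
    (fun i _ hf => contDiff_pderivFun hf i) a l (f := fun _ => f) hf

theorem pderivFun_comm {f : (Fin d → ℝ) → ℝ} (hf : ContDiff ℝ (⊤ : ℕ∞) f) (i j : Fin d) :
    pderivFun i (pderivFun j f) = pderivFun j (pderivFun i f) := by
  have hdiff : Differentiable ℝ (fderiv ℝ f) :=
    (hf.fderiv_right (m := (⊤ : ℕ∞)) (by simp)).differentiable (by simp)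
  have key : ∀ (i j : Fin d) x, pderivFun i (pderivFun j f) x =
      fderiv ℝ (fderiv ℝ f) x (Pi.single i 1) (Pi.single j 1) := by
    intro i j x
    have h := (hdiff x).hasFDerivAt.clm_apply (hasFDerivAt_const (Pi.single j (1 : ℝ)) x)
    change fderiv ℝ (fun y => fderiv ℝ f y (Pi.single j 1)) x (Pi.single i 1) = _
    rw [h.fderiv]
    simp
  ext x
  rw [key, key]
  exact (hf.contDiffAt.isSymmSndFDerivAt (by
    rw [minSmoothness_of_isRCLikeNormedField]
    exact WithTop.coe_le_coe.mpr (le_top : (2 : ℕ∞) ≤ ⊤))).eq _ _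

theorem foldr_pderivFun {f : (Fin d → ℝ) → ℝ} (hf : ContDiff ℝ (⊤ : ℕ∞) f) (i : Fin d)
    (a : Fin d → ℕ) (l : List (Fin d)) :
    l.foldr (fun j g => (pderivFun j)^[a j] g) (pderivFun i f) =
      pderivFun i (l.foldr (fun j g => (pderivFun j)^[a j] g) f) :=
  (foldr_iterate_induction (ι := Bool)
    (R := fun f => ContDiff ℝ (⊤ : ℕ∞) (f false) ∧ f true = pderivFun i (f false))
    (fun j f hf => ⟨contDiff_pderivFun hf.1 j, by
      beta_reduce; rw [hf.2, pderivFun_comm hf.1]⟩) a l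
    (f := fun b => if b then pderivFun i f else f) ⟨hf, rfl⟩).2

theorem foldr_add_single {f : (Fin d → ℝ) → ℝ} (hf : ContDiff ℝ (⊤ : ℕ∞) f) (i : Fin d)
    (a : Fin d → ℕ) (l : List (Fin d)) (hl : l.Nodup) :
    l.foldr (fun j g => (pderivFun j)^[(a + Pi.single i 1 : Fin d → ℕ) j] g) f =
      if i ∈ l then pderivFun i (l.foldr (fun j g => (pderivFun j)^[a j] g) f)
      else l.foldr (fun j g => (pderivFun j)^[a j] g) f := by
  induction l with
  | nil => simp
  | cons j l ih =>
    rw [List.nodup_cons] at hl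
    rw [List.foldr_cons, ih hl.2]
    rcases eq_or_ne j i with rfl | hji
    · simp [hl.1, Function.iterate_succ_apply']
    · by_cases hil : i ∈ l
      · have := foldr_pderivFun (contDiff_foldr hf a l) i a [j]
        simpa [hil, hji] using this
      · simp [hil, hji, hji.symm]

end FoldrDerivatives

section IteratedPartialDerivatives

variable {d : ℕ}

theorem mderiv_pderivFun {f : (Fin d → ℝ) → ℝ} (hf : ContDiff ℝ (⊤ : ℕ∞) f) (i : Fin d)
    (a : Fin d → ℕ) :
    mderiv a (pderivFun i f) = mderiv (a + Pi.single i 1) f := by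
  unfold mderiv
  rw [foldr_pderivFun hf, foldr_add_single hf i a _ (List.nodup_finRange d)]
  simp

theorem mderiv_sum {ι : Type*} (s : Finset ι) (c : ι → ℝ) (f : ι → (Fin d → ℝ) → ℝ)
    (hf : ∀ b, ContDiff ℝ (⊤ : ℕ∞) (f b)) (a : Fin d → ℕ) :
    mderiv a (fun x => ∑ b ∈ s, c b * f b x) = fun x => ∑ b ∈ s, c b * mderiv a (f b) x := by
  refine (foldr_iterate_induction (ι := Option ι)
    (R := fun f => (∀ b, ContDiff ℝ (⊤ : ℕ∞) (f (some b))) ∧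
      f none = fun x => ∑ b ∈ s, c b * f (some b) x) (fun i f hf => ?_) a (List.finRange d)
    (f := fun o => o.elim (fun x => ∑ b ∈ s, c b * f b x) f) ⟨hf, rfl⟩).2
  refine ⟨fun b => contDiff_pderivFun (hf.1 b) i, ?_⟩
  beta_reduce
  rw [hf.2]
  ext x
  have h := HasFDerivAt.fun_sum (u := s) fun b _ =>
    (((hf.1 b).differentiable (by simp) x).hasFDerivAt.const_mul (c b))
  simp [pderivFun, h.fderiv]

theorem mderiv_sub {f g : (Fin d → ℝ) → ℝ} (hf : ContDiff ℝ (⊤ : ℕ∞) f)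
    (hg : ContDiff ℝ (⊤ : ℕ∞) g) (a : Fin d → ℕ) :
    mderiv a (fun x => f x - g x) = fun x => mderiv a f x - mderiv a g x := by
  have h := mderiv_sum Finset.univ (fun b : Bool => if b then 1 else -1)
    (fun b => if b then f else g) (by rintro (_ | _) <;> assumption) a
  simpa [← sub_eq_add_neg] using h

open Polynomial in
theorem pderivFun_prod_eval (p : Fin d → ℝ[X]) (i : Fin d) :
    pderivFun i (fun x => ∏ j, (p j).eval (x j)) =
      fun x => ∏ j, (Function.update p i (derivative (p i)) j).eval (x j) := by
  ext x
  have h := HasFDerivAt.finsetProd (u := Finset.univ) (x := x) fun j _ =>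
    ((p j).hasDerivAt (x j)).comp_hasFDerivAt x (hasFDerivAt_apply (𝕜 := ℝ) j x)
  change fderiv ℝ (fun x => ∏ j, (p j).eval (x j)) x (Pi.single i 1) = _
  simp only [Function.comp_def] at h
  rw [h.fderiv, ← Finset.mul_prod_erase _ _ (Finset.mem_univ i)]
  simp only [_root_.sum_apply, _root_.smul_apply, smul_eq_mul,
    ContinuousLinearMap.proj_apply]
  rw [Finset.sum_eq_single i (fun j _ hj => by simp [hj]) (by simp)]
  simp only [Pi.single_eq_same, Function.update_self, mul_one]
  rw [mul_comm]
  congr 1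
  refine Finset.prod_congr rfl fun j hj => ?_
  rw [Function.update_of_ne (Finset.ne_of_mem_erase hj)]

open Polynomial in
theorem iterate_pderivFun_prod_eval (p : Fin d → ℝ[X]) (i : Fin d) (k : ℕ) :
    (pderivFun i)^[k] (fun x => ∏ j, (p j).eval (x j)) =
      fun x => ∏ j, (Function.update p i (derivative^[k] (p i)) j).eval (x j) := by
  induction k with
  | zero => simp
  | succ k ih =>
    rw [Function.iterate_succ_apply', ih, pderivFun_prod_eval]
    simp [Function.iterate_succ_apply']

open Polynomial in
theorem mderiv_prod_eval (p : Fin d → ℝ[X]) (a : Fin d → ℕ) :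
    mderiv a (fun x => ∏ j, (p j).eval (x j)) =
      fun x => ∏ j, (derivative^[a j] (p j)).eval (x j) := by
  have key : ∀ l : List (Fin d), l.Nodup →
      l.foldr (fun i g => (pderivFun i)^[a i] g) (fun x => ∏ j, (p j).eval (x j)) =
        fun x => ∏ j, (if j ∈ l then derivative^[a j] (p j) else p j).eval (x j) := by
    intro l hl
    induction l with
    | nil => simp
    | cons i l ih =>
      rw [List.nodup_cons] at hl
      rw [List.foldr_cons, ih hl.2, iterate_pderivFun_prod_eval]
      ext x
      refine Finset.prod_congr rfl fun j _ => ?_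
      rcases eq_or_ne j i with rfl | hji
      · simp [hl.1]
      · simp [hji]
  unfold mderiv
  simpa using key _ (List.nodup_finRange d)

theorem mderiv_monomial_zero (a b : Fin d → ℕ) :
    mderiv a (fun x => ∏ j, x j ^ b j) 0 =
      if a = b then ((∏ j, (a j).factorial : ℕ) : ℝ) else 0 := by
  have h := congrFun (mderiv_prod_eval (fun j => Polynomial.X ^ b j) a) 0
  simp only [Polynomial.eval_pow, Polynomial.eval_X] at h
  rw [h]
  have hfac : ∀ j, (Polynomial.derivative^[a j] (Polynomial.X ^ b j : Polynomial ℝ)).eval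
      ((0 : Fin d → ℝ) j) = if a j = b j then ((a j).factorial : ℝ) else 0 := by
    intro j
    rw [Pi.zero_apply, ← Polynomial.coeff_zero_eq_eval_zero, Polynomial.coeff_iterate_derivative]
    simp [Polynomial.coeff_X_pow, Nat.descFactorial_self]
  simp only [hfac]
  split_ifs with hab
  · simp [hab]
  · obtain ⟨j, hj⟩ := Function.ne_iff.mp hab
    exact Finset.prod_eq_zero (Finset.mem_univ j) (if_neg hj)

/-- `f` and all its partial derivatives, in any order, up to total order `n` vanish at `0`. -/
def IsFlat : ℕ → ((Fin d → ℝ) → ℝ) → Prop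
  | 0, f => f 0 = 0
  | n + 1, f => f 0 = 0 ∧ ∀ i, IsFlat n (pderivFun i f)

theorem IsFlat.apply_zero {n : ℕ} {f : (Fin d → ℝ) → ℝ} (h : IsFlat n f) : f 0 = 0 := by
  cases n with
  | zero => exact h
  | succ n => exact h.1

theorem IsFlat.of_succ {n : ℕ} {f : (Fin d → ℝ) → ℝ} (h : IsFlat (n + 1) f) : IsFlat n f := by
  induction n generalizing f with
  | zero => exact h.1
  | succ n ih => exact ⟨h.1, fun i => ih (h.2 i)⟩

theorem IsFlat.add {n : ℕ} {f g : (Fin d → ℝ) → ℝ} (hf : ContDiff ℝ (⊤ : ℕ∞) f)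
    (hg : ContDiff ℝ (⊤ : ℕ∞) g) (hf' : IsFlat n f) (hg' : IsFlat n g) :
    IsFlat n (fun x => f x + g x) := by
  induction n generalizing f g with
  | zero => simp_all [IsFlat]
  | succ n ih =>
    refine ⟨by simp [hf'.1, hg'.1], fun i => ?_⟩
    convert ih (contDiff_pderivFun hf i) (contDiff_pderivFun hg i) (hf'.2 i) (hg'.2 i) using 1
    ext x
    simp [pderivFun, fderiv_fun_add (hf.differentiable (by simp) x)
      (hg.differentiable (by simp) x)]

theorem IsFlat.mul {n : ℕ} {f g : (Fin d → ℝ) → ℝ} (hf : ContDiff ℝ (⊤ : ℕ∞) f)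
    (hg : ContDiff ℝ (⊤ : ℕ∞) g) (hf' : IsFlat n f) : IsFlat n (fun x => f x * g x) := by
  induction n generalizing f g with
  | zero => simp_all [IsFlat]
  | succ n ih =>
    refine ⟨by simp [hf'.1], fun i => ?_⟩
    have hdf := contDiff_pderivFun hf i
    have hdg := contDiff_pderivFun hg i
    convert (ih hf hdg hf'.of_succ).add (hf.mul hdg) (hdf.mul hg) (ih hdf hg (hf'.2 i)) using 1
    ext x
    simp [pderivFun, fderiv_fun_mul (hf.differentiable (by simp) x)
      (hg.differentiable (by simp) x), mul_comm]

theorem IsFlat.mderiv_eq_zero {n : ℕ} {f : (Fin d → ℝ) → ℝ} (hf : ContDiff ℝ (⊤ : ℕ∞) f)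
    (h : IsFlat n f) (a : Fin d → ℕ) (ha : ∑ i, a i ≤ n) : mderiv a f 0 = 0 := by
  induction n generalizing f a with
  | zero =>
    obtain rfl : a = 0 := by ext i; simp_all
    have : mderiv (0 : Fin d → ℕ) f = f := by simp [mderiv]
    rw [this]
    exact h
  | succ n ih =>
    by_cases ha0 : a = 0
    · exact ih hf h.of_succ a (by simp [ha0])
    · obtain ⟨i, hi⟩ := Function.ne_iff.mp ha0
      have hle : Pi.single i 1 ≤ a := by
        intro j
        rcases eq_or_ne j i with rfl | hji
        · simpa using Nat.one_le_iff_ne_zero.mpr hi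
        · simp [hji]
      obtain ⟨b, rfl⟩ := exists_add_of_le hle
      rw [add_comm, ← mderiv_pderivFun hf]
      refine ih (contDiff_pderivFun hf i) (h.2 i) b ?_
      simp [Finset.sum_add_distrib] at ha
      omega

theorem isFlat_of_mderiv {n : ℕ} {f : (Fin d → ℝ) → ℝ} (hf : ContDiff ℝ (⊤ : ℕ∞) f)
    (h : ∀ a : Fin d → ℕ, ∑ i, a i ≤ n → mderiv a f 0 = 0) : IsFlat n f := by
  have h0 : f 0 = 0 := by simpa [mderiv] using h 0 (by simp)
  induction n generalizing f with
  | zero => exact h0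
  | succ n ih =>
    have hd : ∀ i (a : Fin d → ℕ), ∑ j, a j ≤ n → mderiv a (pderivFun i f) 0 = 0 := by
      intro i a ha
      rw [mderiv_pderivFun hf]
      exact h _ (by simpa [Finset.sum_add_distrib] using ha)
    exact ⟨h0, fun i => ih (contDiff_pderivFun hf i) (hd i)
      (by simpa [mderiv] using hd i 0 (by simp))⟩

/-- The Taylor polynomial of order `ω` of `φ` at the origin. -/
noncomputable def taylorPoly (ω : ℕ) (φ : (Fin d → ℝ) → ℝ) : (Fin d → ℝ) → ℝ :=
  fun x => ∑ a ∈ Finset.univ.filter (fun a : Fin d → Fin (ω + 1) => (∑ i, ((a i : ℕ))) ≤ ω),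
    ((∏ i, x i ^ (a i : ℕ)) / ((∏ i, Nat.factorial (a i : ℕ) : ℕ) : ℝ)) *
      mderiv (fun i => (a i : ℕ)) φ 0

theorem contDiff_monomial (b : Fin d → ℕ) :
    ContDiff ℝ (⊤ : ℕ∞) (fun x : Fin d → ℝ => ∏ j, x j ^ b j) :=
  contDiff_prod fun j _ => (contDiff_apply ℝ ℝ j).pow (b j)

theorem contDiff_taylorPoly (ω : ℕ) (φ : (Fin d → ℝ) → ℝ) :
    ContDiff ℝ (⊤ : ℕ∞) (taylorPoly ω φ) :=
  ContDiff.sum fun _ _ => ((contDiff_monomial _).div_const _).mul contDiff_const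

theorem mderiv_taylorPoly_zero (ω : ℕ) (φ : (Fin d → ℝ) → ℝ) (a : Fin d → ℕ)
    (ha : ∑ i, a i ≤ ω) : mderiv a (taylorPoly ω φ) 0 = mderiv a φ 0 := by
  have hT : taylorPoly ω φ = fun x =>
      ∑ b ∈ Finset.univ.filter (fun b : Fin d → Fin (ω + 1) => (∑ i, ((b i : ℕ))) ≤ ω),
        (mderiv (fun i => (b i : ℕ)) φ 0 / ((∏ i, Nat.factorial (b i : ℕ) : ℕ) : ℝ)) *
          ∏ i, x i ^ (b i : ℕ) := by
    ext x
    exact Finset.sum_congr rfl fun b _ => by ring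
  have hlt : ∀ i, a i < ω + 1 := fun i =>
    Nat.lt_succ_of_le <|
      (Finset.single_le_sum (fun _ _ => Nat.zero_le _) (Finset.mem_univ i)).trans ha
  rw [hT, mderiv_sum _
    (fun b : Fin d → Fin (ω + 1) =>
      mderiv (fun i => (b i : ℕ)) φ 0 / ((∏ i, Nat.factorial (b i : ℕ) : ℕ) : ℝ))
    (fun b x => ∏ i, x i ^ (b i : ℕ))
    fun b => contDiff_monomial fun i => (b i : ℕ)]
  simp only [mderiv_monomial_zero]
  rw [Finset.sum_eq_single (fun i => ⟨a i, hlt i⟩)]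
  · have hne : ((∏ i, (a i).factorial : ℕ) : ℝ) ≠ 0 :=
      Nat.cast_ne_zero.mpr (Finset.prod_ne_zero_iff.mpr fun i _ => Nat.factorial_ne_zero _)
    simp only [if_true]
    exact div_mul_cancel₀ _ hne
  · intro b _ hb
    rw [if_neg, mul_zero]
    rintro rfl
    exact hb rfl
  · intro h
    simp [ha] at h

end IteratedPartialDerivatives

/-- `W` maps test functions into the space `𝒟_ω` of functions flat to order `ω`
at the origin: all partial derivatives of `Wφ` of order `≤ ω` vanish at `0`. -/
theorem EGsub_flat (d ω : ℕ) (hd : 1 ≤ d) (w : (Fin d → ℝ) → ℝ) (hw : IsAdmissible d ω w)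
    (φ : (Fin d → ℝ) → ℝ) (hφ : ContDiff ℝ (⊤ : ℕ∞) φ)
    (a : Fin d → ℕ) (ha : (∑ i, a i) ≤ ω) :
    mderiv a (EGsub d ω w φ) 0 = 0 := by

  obtain ⟨hws, hw0, hwd⟩ := hw
  have hT := contDiff_taylorPoly ω φ
  have hR : ContDiff ℝ (⊤ : ℕ∞) (fun x => φ x - taylorPoly ω φ x) := hφ.sub hT
  have hv : ContDiff ℝ (⊤ : ℕ∞) (fun x => 1 - w x) := contDiff_const.sub hws
  have hRflat : IsFlat ω (fun x => φ x - taylorPoly ω φ x) :=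
    isFlat_of_mderiv hR fun b hb => by
      rw [mderiv_sub hφ hT]
      simp [mderiv_taylorPoly_zero ω φ b hb]
  have hvflat : IsFlat ω (fun x => 1 - w x) :=
    isFlat_of_mderiv hv fun b hb => by
      rcases eq_or_ne b 0 with rfl | hb0
      · simp [mderiv, hw0]
      · have hone := mderiv_monomial_zero b 0
        simp only [Pi.zero_apply, pow_zero, Finset.prod_const_one, if_neg hb0] at hone
        have hpos : 1 ≤ ∑ i, b i := by
          by_contra! h
          exact hb0 (by ext i; simp_all)
        rw [mderiv_sub contDiff_const hws]
        simp [hone, hwd b hpos hb]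
  have hEG : EGsub d ω w φ =
      fun x => (φ x - taylorPoly ω φ x) + (1 - w x) * taylorPoly ω φ x := by
    ext x
    change φ x - w x * taylorPoly ω φ x = _
    ring
  rw [hEG]
  exact (hRflat.add hR (hv.mul hT) (hvflat.mul hv hT)).mderiv_eq_zero
    (hR.add (hv.mul hT)) a ha
end

section
/- (Scaling degree and multiplication by monomials.) Let f ∈ 𝒮'(ℝⁿ), let a be a multi-index with |a| = Σᵢ aᵢ, and let x^a f ∈ 𝒮'(ℝⁿ) be defined by ⟨x^a f, φ⟩ := ⟨f, x^a φ⟩, where x^a = Πᵢ xᵢ^{aᵢ}. If s ∈ ℝ is a scaling bound for f, then s − |a| is a scaling bound for x^a f; consequently, the scaling degree satisfies σ(x^a f) ≤ σ(f) − |a|. -/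
open SchwartzMap Filter Topology Set

noncomputable section

/-- `ℝⁿ` with the Euclidean norm. -/
abbrev Eucl (n : ℕ) := EuclideanSpace ℝ (Fin n)

/-- The continuous linear equivalence `x ↦ c • x` of `ℝⁿ`, for `c ≠ 0`. -/
def smulEquiv (n : ℕ) (c : ℝ) (hc : c ≠ 0) : Eucl n ≃L[ℝ] Eucl n :=
  { LinearEquiv.smulOfNeZero ℝ (Eucl n) c hc with
    continuous_toFun := continuous_const_smul c
    continuous_invFun := continuous_const_smul c⁻¹ }

/-- The dilate `x ↦ φ(x/λ)` of a Schwartz function (junk value `φ` for `λ = 0`). -/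
def dilate {n : ℕ} (lam : ℝ) (φ : 𝓢(Eucl n, ℝ)) : 𝓢(Eucl n, ℝ) :=
  if hlam : lam = 0 then φ
  else SchwartzMap.compCLMOfContinuousLinearEquiv ℝ (smulEquiv n lam⁻¹ (inv_ne_zero hlam)) φ

/-- `s` is a scaling bound (at the origin) for the tempered distribution `f`:
`λ^s ⟨f_λ, φ⟩ → 0` as `λ → 0⁺`, where `⟨f_λ, φ⟩ := λ^{−n} ⟨f, φ(·/λ)⟩`. -/
def IsScalingBound (n : ℕ) (f : 𝓢(Eucl n, ℝ) →L[ℝ] ℝ) (s : ℝ) : Prop :=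
  ∀ φ : 𝓢(Eucl n, ℝ),
    Tendsto (fun lam : ℝ => lam ^ s * (lam ^ (-(n : ℝ)) * f (dilate lam φ)))
      (nhdsWithin 0 (Set.Ioi 0)) (nhds 0)

/-- The scaling degree of `f` at the origin: the infimum of its scaling bounds
(in the extended reals). -/
def scalingDegree (n : ℕ) (f : 𝓢(Eucl n, ℝ) →L[ℝ] ℝ) : EReal :=
  sInf {x : EReal | ∃ s : ℝ, x = (s : EReal) ∧ IsScalingBound n f s}

lemma dilate_apply {n : ℕ} {lam : ℝ} (hlam : lam ≠ 0) (φ : 𝓢(Eucl n, ℝ)) (x : Eucl n) :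
    dilate lam φ x = φ (lam⁻¹ • x) := by
  rw [dilate, dif_neg hlam]
  rfl

/-- Multiplication by `x^a` commutes with dilation up to the factor `λ^|a|`. -/
lemma monomial_mul_dilate {n : ℕ} (a : Fin n → ℕ) (M : 𝓢(Eucl n, ℝ) →L[ℝ] 𝓢(Eucl n, ℝ))
    (hM : ∀ (φ : 𝓢(Eucl n, ℝ)) (x : Eucl n), M φ x = (∏ i, x i ^ a i) * φ x)
    {lam : ℝ} (hlam : lam ≠ 0) (φ : 𝓢(Eucl n, ℝ)) :
    M (dilate lam φ) = lam ^ (∑ i, a i) • dilate lam (M φ) := by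
  ext x
  rw [_root_.smul_apply, hM, dilate_apply hlam, dilate_apply hlam, hM, smul_eq_mul,
    ← mul_assoc, ← Finset.prod_pow_eq_pow_sum, ← Finset.prod_mul_distrib]
  congr 1
  refine Finset.prod_congr rfl fun i _ => ?_
  rw [PiLp.smul_apply, smul_eq_mul, ← mul_pow, mul_inv_cancel_left₀ hlam]

lemma IsScalingBound.monomial_mul {n : ℕ} {f : 𝓢(Eucl n, ℝ) →L[ℝ] ℝ} {s : ℝ}
    (hs : IsScalingBound n f s) (a : Fin n → ℕ) (M : 𝓢(Eucl n, ℝ) →L[ℝ] 𝓢(Eucl n, ℝ))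
    (hM : ∀ (φ : 𝓢(Eucl n, ℝ)) (x : Eucl n), M φ x = (∏ i, x i ^ a i) * φ x) :
    IsScalingBound n (f.comp M) (s - (∑ i, a i : ℕ)) := by
  intro φ
  refine (hs (M φ)).congr' ?_
  filter_upwards [self_mem_nhdsWithin] with lam hlam
  have hpos : 0 < lam := hlam
  have hpow : lam ^ (∑ i, a i) ≠ 0 := pow_ne_zero _ hpos.ne'
  rw [ContinuousLinearMap.comp_apply, monomial_mul_dilate a M hM hpos.ne', map_smul, smul_eq_mul,
    Real.rpow_sub hpos, Real.rpow_natCast]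
  field_simp

/-- if `s` is a scaling bound for `f`, then `s − |a|` is a scaling bound for
`x^a f`, `⟨x^a f, φ⟩ := ⟨f, x^a φ⟩`; consequently `σ(x^a f) ≤ σ(f) − |a|`. Here `M` is the
operator of multiplication by the monomial `x^a` on Schwartz space. -/
theorem scaling_of_monomial_mul (n : ℕ) (f : 𝓢(Eucl n, ℝ) →L[ℝ] ℝ) (a : Fin n → ℕ)
    (M : 𝓢(Eucl n, ℝ) →L[ℝ] 𝓢(Eucl n, ℝ))
    (hM : ∀ (φ : 𝓢(Eucl n, ℝ)) (x : Eucl n), M φ x = (∏ i, x i ^ a i) * φ x) :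
    (∀ s : ℝ, IsScalingBound n f s → IsScalingBound n (f.comp M) (s - (∑ i, a i : ℕ))) ∧
    scalingDegree n (f.comp M) ≤ scalingDegree n f - (((∑ i, a i : ℕ) : ℝ) : EReal) := by
  have key : ∀ s : ℝ, IsScalingBound n f s →
      IsScalingBound n (f.comp M) (s - (∑ i, a i : ℕ)) := fun s hs => hs.monomial_mul a M hM
  refine ⟨key, ?_⟩
  rw [EReal.le_sub_iff_add_le (Or.inl (EReal.coe_ne_bot _)) (Or.inl (EReal.coe_ne_top _))]
  refine le_sInf ?_
  rintro _ ⟨s, rfl, hs⟩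
  rw [← EReal.le_sub_iff_add_le (Or.inl (EReal.coe_ne_bot _)) (Or.inl (EReal.coe_ne_top _)),
    ← EReal.coe_sub]
  exact sInf_le ⟨_, rfl, key s hs⟩
end
end

section
/- (Point-supported distributions of low scaling degree vanish.) Let t ∈ 𝒮'(ℝⁿ) be such that ⟨t, φ⟩ = 0 for every Schwartz function φ that vanishes on some neighbourhood of the origin (i.e. t is supported at {0}), and suppose some s < n is a scaling bound for t. Then t = 0. -/
open SchwartzMap Filter Topology Set

noncomputable section

lemma lp_one_summable_norm {ι : Type*} (a : lp (fun _ : ι => ℝ) 1) :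
    Summable fun j => ‖a j‖ := by
  simpa using (lp.hasSum_norm (by simp) a).summable

lemma lp_one_norm_eq_tsum {ι : Type*} (a : lp (fun _ : ι => ℝ) 1) :
    ‖a‖ = ∑' j, ‖a j‖ := by
  simpa using (lp.hasSum_norm (by simp) a).tsum_eq.symm

section Series

variable {ι E F : Type*} [NormedAddCommGroup E] [NormedSpace ℝ E]
  [NormedAddCommGroup F] [NormedSpace ℝ F]

lemma norm_iteratedFDeriv_smul_le_of_bound {g : ι → 𝓢(E, F)} {C : ℕ → ℕ → ℝ}
    (hC : ∀ k l j x, ‖x‖ ^ k * ‖iteratedFDeriv ℝ l (g j) x‖ ≤ C k l)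
    (a : lp (fun _ : ι => ℝ) 1) (k l : ℕ) (j : ι) (x : E) :
    ‖x‖ ^ k * ‖iteratedFDeriv ℝ l (fun y => a j • g j y) x‖ ≤ ‖a j‖ * C k l := by
  rw [iteratedFDeriv_const_smul_apply' ((g j).contDiffAt l), norm_smul]
  calc _ = ‖a j‖ * (‖x‖ ^ k * ‖iteratedFDeriv ℝ l (g j) x‖) := by ring
    _ ≤ _ := by gcongr; exact hC k l j x

variable [CompleteSpace F]

lemma pow_mul_norm_iteratedFDeriv_tsum_le {g : ι → 𝓢(E, F)} {C : ℕ → ℕ → ℝ}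
    (hC : ∀ k l j x, ‖x‖ ^ k * ‖iteratedFDeriv ℝ l (g j) x‖ ≤ C k l)
    (a : lp (fun _ : ι => ℝ) 1) (k l : ℕ) (x : E) :
    ‖x‖ ^ k * ‖iteratedFDeriv ℝ l (fun y => ∑' j, a j • g j y) x‖ ≤ ‖a‖ * C k l := by
  have hs := lp_one_summable_norm a
  have h0 : ∀ l j y, ‖iteratedFDeriv ℝ l (fun y => a j • g j y) y‖ ≤ ‖a j‖ * C 0 l := fun l j y => by
    simpa using norm_iteratedFDeriv_smul_le_of_bound hC a 0 l j y
  rw [iteratedFDeriv_tsum_apply (N := ⊤) (v := fun l j => ‖a j‖ * C 0 l)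
    (fun j => ((g j).smooth ⊤).const_smul (a j)) (fun l _ => hs.mul_right _)
    (fun l j y _ => h0 l j y) le_top]
  have hn : Summable fun j => ‖iteratedFDeriv ℝ l (fun y => a j • g j y) x‖ :=
    Summable.of_nonneg_of_le (fun _ => norm_nonneg _) (fun j => h0 l j x) (hs.mul_right _)
  calc _ ≤ ‖x‖ ^ k * ∑' j, ‖iteratedFDeriv ℝ l (fun y => a j • g j y) x‖ := by
        gcongr; exact norm_tsum_le_tsum_norm hn
    _ = ∑' j, ‖x‖ ^ k * ‖iteratedFDeriv ℝ l (fun y => a j • g j y) x‖ := by rw [tsum_mul_left]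
    _ ≤ ∑' j, ‖a j‖ * C k l :=
        (hn.mul_left _).tsum_le_tsum (fun j => norm_iteratedFDeriv_smul_le_of_bound hC a k l j x)
          (hs.mul_right _)
    _ = _ := by rw [tsum_mul_right, lp_one_norm_eq_tsum]

/-- A bounded family `g` of Schwartz functions induces the linear map `a ↦ ∑ j, a j • g j`
from `ℓ¹` to the Schwartz space. -/
def schwartzSeriesLM (g : ι → 𝓢(E, F)) (C : ℕ → ℕ → ℝ)
    (hC : ∀ k l j x, ‖x‖ ^ k * ‖iteratedFDeriv ℝ l (g j) x‖ ≤ C k l) :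
    lp (fun _ : ι => ℝ) 1 →ₗ[ℝ] 𝓢(E, F) where
  toFun a :=
    { toFun := fun x => ∑' j, a j • g j x
      smooth' := contDiff_tsum (N := ⊤) (v := fun l j => ‖a j‖ * C 0 l)
        (fun j => ((g j).smooth ⊤).const_smul (a j))
        (fun l _ => (lp_one_summable_norm a).mul_right _)
        (fun l j x _ => by simpa using norm_iteratedFDeriv_smul_le_of_bound hC a 0 l j x)
      decay' := fun k l => ⟨‖a‖ * C k l, pow_mul_norm_iteratedFDeriv_tsum_le hC a k l⟩ }
  map_add' a b := by
    have hsum : ∀ (a : lp (fun _ : ι => ℝ) 1) x, Summable fun j => a j • g j x := fun a x =>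
      Summable.of_norm_bounded ((lp_one_summable_norm a).mul_right (C 0 0)) fun j => by
        simpa using norm_iteratedFDeriv_smul_le_of_bound hC a 0 0 j x
    ext x
    change ∑' j, (a + b) j • g j x = ∑' j, a j • g j x + ∑' j, b j • g j x
    simp_rw [lp.coeFn_add, Pi.add_apply, add_smul]
    exact (hsum a x).tsum_add (hsum b x)
  map_smul' c a := by
    ext x
    change ∑' j, (c • a) j • g j x = c • ∑' j, a j • g j x
    simp_rw [lp.coeFn_smul, Pi.smul_apply, smul_assoc]
    exact tsum_const_smul'' c

/-- The map `schwartzSeriesLM` as a continuous linear map. -/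
def schwartzSeries (g : ι → 𝓢(E, F)) (C : ℕ → ℕ → ℝ)
    (hC : ∀ k l j x, ‖x‖ ^ k * ‖iteratedFDeriv ℝ l (g j) x‖ ≤ C k l) :
    lp (fun _ : ι => ℝ) 1 →L[ℝ] 𝓢(E, F) where
  toLinearMap := schwartzSeriesLM g C hC
  cont := by
    refine (schwartz_withSeminorms ℝ E F).continuous_normedSpace_dom (τ₁₂ := .id ℝ)
      (lp (fun _ : ι => ℝ) 1) (schwartzSeriesLM g C hC) ?_
    rintro ⟨k, l⟩
    refine ⟨(max (C k l) 0).toNNReal, fun a => ?_⟩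
    refine SchwartzMap.seminorm_le_bound ℝ k l _ (by positivity) fun x => ?_
    refine (pow_mul_norm_iteratedFDeriv_tsum_le hC a k l x).trans ?_
    change _ ≤ ((max (C k l) 0).toNNReal : ℝ) * ‖a‖
    rw [Real.coe_toNNReal _ (le_max_right _ _), mul_comm]
    gcongr
    exact le_max_left _ _

lemma schwartzSeries_single [DecidableEq ι] (g : ι → 𝓢(E, F)) (C : ℕ → ℕ → ℝ)
    (hC : ∀ k l j x, ‖x‖ ^ k * ‖iteratedFDeriv ℝ l (g j) x‖ ≤ C k l) (i : ι) :
    schwartzSeries g C hC (lp.single 1 i 1) = g i := by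
  ext x
  change ∑' j, (lp.single 1 i (1 : ℝ) : lp (fun _ : ι => ℝ) 1) j • g j x = g i x
  rw [tsum_eq_single i]
  · simp
  · intro j hj
    simp [hj]

/-- Uniform boundedness principle on the Schwartz space: a pointwise bounded family of continuous
linear maps is uniformly bounded along every bounded family of Schwartz functions. -/
lemma exists_bound_of_pointwise_bounded {G : Type*} [NormedAddCommGroup G] [NormedSpace ℝ G]
    (T : ι → 𝓢(E, F) →L[ℝ] G) (hT : ∀ φ, ∃ M, ∀ i, ‖T i φ‖ ≤ M)
    (g : ι → 𝓢(E, F)) (hg : ∀ k l, ∃ C, ∀ j x, ‖x‖ ^ k * ‖iteratedFDeriv ℝ l (g j) x‖ ≤ C) :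
    ∃ M, ∀ i, ‖T i (g i)‖ ≤ M := by
  classical
  choose C hC using hg
  obtain ⟨M, hM⟩ := banach_steinhaus (g := fun i => (T i).comp (schwartzSeries g C hC))
    fun a => hT (schwartzSeries g C hC a)
  refine ⟨M, fun i => ?_⟩
  have h := ((T i).comp (schwartzSeries g C hC)).le_of_opNorm_le (hM i) (lp.single 1 i 1)
  rwa [ContinuousLinearMap.comp_apply, schwartzSeries_single, lp.norm_single (by simp), norm_one,
    mul_one] at h

end Series

lemma norm_iteratedFDeriv_dilate_le {n : ℕ} {lam : ℝ} (hlam : 1 ≤ lam) (φ : 𝓢(Eucl n, ℝ)) (l : ℕ)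
    (x : Eucl n) :
    ‖iteratedFDeriv ℝ l (dilate lam φ) x‖ ≤ SchwartzMap.seminorm ℝ 0 l φ := by
  have hlam0 : lam ≠ 0 := by positivity
  have h : (dilate lam φ : Eucl n → ℝ) = fun x => φ (lam⁻¹ • x) := funext (dilate_apply hlam0 φ)
  rw [h, iteratedFDeriv_comp_const_smul lam⁻¹ (φ.smooth l), norm_smul]
  have h1 : ‖lam⁻¹ ^ l‖ ≤ 1 := by
    rw [norm_pow, norm_inv, Real.norm_of_nonneg (by positivity)]
    exact pow_le_one₀ (by positivity) (inv_le_one_of_one_le₀ hlam)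
  calc _ ≤ 1 * SchwartzMap.seminorm ℝ 0 l φ := by
        gcongr
        exact φ.norm_iteratedFDeriv_le_seminorm ℝ l _
    _ = _ := one_mul _

lemma exists_bound_smulLeftCLM_dilate {n : ℕ} (χ φ : 𝓢(Eucl n, ℝ)) (k l : ℕ) :
    ∃ C, ∀ lam : ℝ, 1 ≤ lam → ∀ x,
      ‖x‖ ^ k * ‖iteratedFDeriv ℝ l (smulLeftCLM ℝ χ (dilate lam φ)) x‖ ≤ C := by
  refine ⟨∑ i ∈ Finset.range (l + 1), (l.choose i : ℝ) * SchwartzMap.seminorm ℝ k i χ *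
    SchwartzMap.seminorm ℝ 0 (l - i) φ, fun lam hlam x => ?_⟩
  have h : (smulLeftCLM ℝ χ (dilate lam φ) : Eucl n → ℝ) = fun x => χ x * dilate lam φ x :=
    funext fun x => smulLeftCLM_apply_apply χ.hasTemperateGrowth _ x
  rw [h]
  calc _ ≤ ‖x‖ ^ k * ∑ i ∈ Finset.range (l + 1), (l.choose i : ℝ) * ‖iteratedFDeriv ℝ i χ x‖ *
        ‖iteratedFDeriv ℝ (l - i) (dilate lam φ) x‖ := by
        gcongr
        exact norm_iteratedFDeriv_mul_le (χ.smooth ⊤) ((dilate lam φ).smooth ⊤) x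
          (WithTop.coe_le_coe.2 le_top)
    _ = ∑ i ∈ Finset.range (l + 1), (l.choose i : ℝ) * (‖x‖ ^ k * ‖iteratedFDeriv ℝ i χ x‖) *
        ‖iteratedFDeriv ℝ (l - i) (dilate lam φ) x‖ := by
        rw [Finset.mul_sum]
        exact Finset.sum_congr rfl fun i _ => by ring
    _ ≤ _ := by
        gcongr with i
        · exact χ.le_seminorm ℝ k i x
        · exact norm_iteratedFDeriv_dilate_le hlam φ (l - i) x

lemma exists_schwartz_eventually_eq_one (E : Type*) [NormedAddCommGroup E] [InnerProductSpace ℝ E]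
    [FiniteDimensional ℝ E] : ∃ χ : 𝓢(E, ℝ), ∀ᶠ x in 𝓝 0, χ x = 1 := by
  let b : ContDiffBump (0 : E) := default
  exact ⟨b.hasCompactSupport.toSchwartzMap b.contDiff, b.eventuallyEq_one⟩

/-- a tempered distribution supported at the origin which admits a scaling
bound `s < n` vanishes. -/
theorem point_supported_low_scaling_eq_zero (n : ℕ) (t : 𝓢(Eucl n, ℝ) →L[ℝ] ℝ)
    (hsupp : ∀ φ : 𝓢(Eucl n, ℝ), (∀ᶠ x in nhds (0 : Eucl n), φ x = 0) → t φ = 0)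
    (s : ℝ) (hs : s < n) (hb : IsScalingBound n t s) :
    t = 0 := by
  obtain ⟨χ, hχ⟩ := exists_schwartz_eventually_eq_one (Eucl n)
  ext φ
  change t φ = 0
  let ε : ℕ → ℝ := fun j => ((j : ℝ) + 1)⁻¹
  have hε : ∀ j, 0 < ε j := fun j => by positivity
  have hε1 : ∀ j, 1 ≤ (ε j)⁻¹ := fun j => by simp [ε]
  have hε0 : Tendsto ε atTop (𝓝[>] 0) :=
    tendsto_nhdsWithin_iff.2 ⟨by simpa [ε] using tendsto_one_div_add_atTop_nhds_zero_nat (𝕜 := ℝ),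
      .of_forall hε⟩
  let T : ℕ → 𝓢(Eucl n, ℝ) →L[ℝ] ℝ := fun j =>
    (ε j ^ s * ε j ^ (-(n : ℝ))) • t.comp (SchwartzMap.compCLMOfContinuousLinearEquiv ℝ
      (smulEquiv n (ε j)⁻¹ (inv_ne_zero (hε j).ne')))
  have hT : ∀ j ψ, T j ψ = ε j ^ s * (ε j ^ (-(n : ℝ)) * t (dilate (ε j) ψ)) := fun j ψ => by
    simp [T, dilate, (hε j).ne', mul_assoc]
  let g : ℕ → 𝓢(Eucl n, ℝ) := fun j => smulLeftCLM ℝ χ (dilate (ε j)⁻¹ φ)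
  have hg : ∀ j, t (dilate (ε j) (g j)) = t φ := fun j => by
    rw [← sub_eq_zero, ← map_sub]
    refine hsupp _ ?_
    have hlim : Tendsto (fun x : Eucl n => (ε j)⁻¹ • x) (𝓝 0) (𝓝 0) := by
      simpa using (continuous_const_smul (ε j)⁻¹).tendsto (0 : Eucl n)
    filter_upwards [hlim.eventually hχ] with x hx
    rw [sub_apply, dilate_apply (hε j).ne', smulLeftCLM_apply_apply χ.hasTemperateGrowth,
      dilate_apply (inv_ne_zero (hε j).ne'), hx, inv_inv, smul_inv_smul₀ (hε j).ne', one_smul,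
      sub_self]
  obtain ⟨M, hM⟩ := exists_bound_of_pointwise_bounded T
    (fun ψ => by
      obtain ⟨M, hM⟩ := ((hb ψ).comp hε0).norm.bddAbove_range
      exact ⟨M, fun j => (hT j ψ).symm ▸ hM (mem_range_self j)⟩)
    g (fun k l => by
      obtain ⟨C, hC⟩ := exists_bound_smulLeftCLM_dilate χ φ k l
      exact ⟨C, fun j x => hC _ (hε1 j) x⟩)
  by_contra hne
  have hgrow : Tendsto (fun j : ℕ => ((j : ℝ) + 1) ^ ((n : ℝ) - s) * ‖t φ‖) atTop atTop :=
    (((tendsto_rpow_atTop (sub_pos.2 hs)).comp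
      (tendsto_atTop_add_const_right _ 1 tendsto_natCast_atTop_atTop)).atTop_mul_const
      (norm_pos_iff.2 hne))
  obtain ⟨j, hj⟩ := (hgrow.eventually_gt_atTop M).exists
  refine absurd (hM j) (not_le.2 (hj.trans_eq ?_))
  rw [hT, hg, ← mul_assoc, ← Real.rpow_add (hε j), norm_mul,
    Real.norm_of_nonneg (Real.rpow_nonneg (hε j).le _), Real.inv_rpow (by positivity),
    ← Real.rpow_neg (by positivity)]
  ring_nf
end
end

section
/- (Scaling degree of a homogeneous distribution.) Let k ∈ ℝ and let t ∈ 𝒮'(ℝⁿ) be nonzero and homogeneous of degree −k, meaning t_λ = λ^{−k} t for every λ > 0. Then the set of scaling bounds of t is exactly {s ∈ ℝ : s > k}, and hence σ(t) = k; the scaling degree generalizes the degree of a homogeneous distribution. -/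
open SchwartzMap Filter Topology Set

noncomputable section

theorem tendsto_rpow_nhdsGT_zero_iff {a : ℝ} :
    Tendsto (fun x : ℝ => x ^ a) (𝓝[>] 0) (𝓝 0) ↔ 0 < a := by
  refine ⟨fun h => ?_, fun ha => ?_⟩
  · by_contra! ha
    refine absurd (ge_of_tendsto h (b := 1) ?_) (by norm_num)
    filter_upwards [Ioo_mem_nhdsGT (zero_lt_one' ℝ)] with x hx
    exact Real.one_le_rpow_of_pos_of_le_one_of_nonpos hx.1 hx.2.le ha
  · simpa [Real.zero_rpow ha.ne'] using
      (Real.continuousAt_rpow_const 0 a (Or.inr ha.le)).tendsto.mono_left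
        (nhdsWithin_le_nhds (s := Ioi 0))

theorem EReal.sInf_coe_Ioi (k : ℝ) : sInf ((↑) '' Ioi k : Set EReal) = k := by
  refine le_antisymm (le_of_forall_gt_imp_ge_of_dense fun b hb => ?_) (le_sInf ?_)
  · obtain ⟨s, hks, hsb⟩ := EReal.lt_iff_exists_real_btwn.1 hb
    exact (sInf_le (mem_image_of_mem _ (EReal.coe_lt_coe_iff.1 hks))).trans hsb.le
  · rintro _ ⟨s, hs, rfl⟩
    exact EReal.coe_le_coe_iff.2 (le_of_lt hs)

theorem isScalingBound_iff_of_homogeneous {n : ℕ} {k : ℝ} {t : 𝓢(Eucl n, ℝ) →L[ℝ] ℝ}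
    (ht : t ≠ 0)
    (hhom : ∀ lam : ℝ, 0 < lam → ∀ φ : 𝓢(Eucl n, ℝ),
      lam ^ (-(n : ℝ)) * t (dilate lam φ) = lam ^ (-k) * t φ) (s : ℝ) :
    IsScalingBound n t s ↔ k < s := by
  have key (φ : 𝓢(Eucl n, ℝ)) :
      (fun lam : ℝ => lam ^ s * (lam ^ (-(n : ℝ)) * t (dilate lam φ)))
        =ᶠ[𝓝[>] 0] fun lam => lam ^ (s - k) * t φ := by
    filter_upwards [self_mem_nhdsWithin] with lam hlam
    rw [hhom lam hlam, ← mul_assoc, ← Real.rpow_add hlam, sub_eq_add_neg]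
  rw [← sub_pos, ← tendsto_rpow_nhdsGT_zero_iff]
  refine ⟨fun h => ?_, fun h φ => ?_⟩
  · obtain ⟨φ, hφ⟩ : ∃ φ, t φ ≠ 0 := by
      by_contra! h0
      exact ht (ContinuousLinearMap.ext h0)
    simpa [hφ] using ((h φ).congr' (key φ)).mul_const (t φ)⁻¹
  · simpa using (h.mul_const (t φ)).congr' (key φ).symm

/-- a nonzero tempered distribution homogeneous of degree `−k` (i.e.
`t_λ = λ^{−k} t` for all `λ > 0`) has as scaling bounds exactly the reals `s > k`, and
hence `σ(t) = k`. -/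
theorem scalingDegree_of_homogeneous (n : ℕ) (k : ℝ) (t : 𝓢(Eucl n, ℝ) →L[ℝ] ℝ)
    (ht : t ≠ 0)
    (hhom : ∀ lam : ℝ, 0 < lam → ∀ φ : 𝓢(Eucl n, ℝ),
      lam ^ (-(n : ℝ)) * t (dilate lam φ) = lam ^ (-k) * t φ) :
    {s : ℝ | IsScalingBound n t s} = {s : ℝ | k < s} ∧
    scalingDegree n t = (k : EReal) := by
  have hbound := isScalingBound_iff_of_homogeneous ht hhom
  refine ⟨Set.ext hbound, ?_⟩
  rw [← EReal.sInf_coe_Ioi k, scalingDegree]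
  congr 1
  ext x
  simp only [hbound, mem_ofPred_eq, mem_image, mem_Ioi]
  exact exists_congr fun s => by rw [and_comm, eq_comm]
end
end
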